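/- Let m ∈ ℕ, let μ be a probability distribution on {0,1}^m, let s = |{v ∈ {0,1}^m : μ(v) > 0}| be the size of its support, and set n = s + 1. Then for every ε > 0 there exists a binary-binary restricted Boltzmann machine π with m visible and n hidden units such that |μ(v) − Σ_{h ∈ {0,1}^n} π(v,h)| ≤ ε for all v ∈ {0,1}^m. -/

import Mathlib

open MeasureTheory Filter

noncomputable section

/-- Value of a binary unit as a real number. -/
def bval (b : Bool) : ℝ := if b then 1 else 0

/-- Unnormalized Gibbs weight of a binary-binary RBM with weight matrix `W` and biases `b`, `c`. -/
def rbmWeight {m n : ℕ} (W : Matrix (Fin m) (Fin n) ℝ) (b : Fin m → ℝ) (c : Fin n → ℝ)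
    (h₁ : Fin m → Bool) (h₂ : Fin n → Bool) : ℝ :=
  Real.exp ((∑ i, ∑ j, bval (h₁ i) * W i j * bval (h₂ j)) +
    (∑ i, bval (h₁ i) * b i) + (∑ j, bval (h₂ j) * c j))

/-- `π` is the distribution of a binary-binary restricted Boltzmann machine with `m` visible
and `n` hidden units. -/
def IsRBM {m n : ℕ} (π : (Fin m → Bool) → (Fin n → Bool) → ℝ) : Prop :=
  ∃ (W : Matrix (Fin m) (Fin n) ℝ) (b : Fin m → ℝ) (c : Fin n → ℝ),
    ∀ h₁ h₂, π h₁ h₂ = rbmWeight W b c h₁ h₂ /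
      ∑ g₁ : Fin m → Bool, ∑ g₂ : Fin n → Bool, rbmWeight W b c g₁ g₂

/-- The rescaled and translated parental density `φ_{μ,σ}(x) = σ^{-d} φ((x-μ)/σ)`. -/
def shift (d : ℕ) (φ : (Fin d → ℝ) → ℝ) (μ : Fin d → ℝ) (σ : ℝ) : (Fin d → ℝ) → ℝ :=
  fun x => (σ ^ d)⁻¹ * φ (fun i => (x i - μ i) / σ)

/-- `p` is the density of the visible units of a deep belief network with parental density `φ`,
`d` real-valued visible units and binary hidden layers of sizes `m` and `n`. -/
def IsDBN (d m n : ℕ) (φ : (Fin d → ℝ) → ℝ) (p : (Fin d → ℝ) → ℝ) : Prop :=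
  ∃ σ : ℝ, 0 < σ ∧ ∃ (μ : (Fin m → Bool) → (Fin d → ℝ))
      (π : (Fin m → Bool) → (Fin n → Bool) → ℝ), IsRBM π ∧
    ∀ v, p v = ∑ h₁ : Fin m → Bool, (∑ h₂ : Fin n → Bool, π h₁ h₂) * shift d φ (μ h₁) σ v

end

/-- Summing out the hidden units of an RBM leaves a product over the hidden units. -/
theorem sum_rbmWeight {m n : ℕ} (W : Matrix (Fin m) (Fin n) ℝ) (b : Fin m → ℝ) (c : Fin n → ℝ)
    (v : Fin m → Bool) :
    ∑ h, rbmWeight W b c v h =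
      Real.exp (∑ i, bval (v i) * b i) * ∏ j, (1 + Real.exp (∑ i, bval (v i) * W i j + c j)) := by
  have key (j : Fin n) : 1 + Real.exp (∑ i, bval (v i) * W i j + c j) =
      ∑ x : Bool, Real.exp (bval x * (∑ i, bval (v i) * W i j + c j)) := by
    simp [bval, add_comm]
  simp_rw [key]
  rw [Finset.prod_univ_sum, Fintype.piFinset_univ, Finset.mul_sum]
  refine Finset.sum_congr rfl fun h _ => ?_
  rw [← Real.exp_sum, ← Real.exp_add, rbmWeight, Finset.sum_comm]
  congr 1
  simp_rw [mul_add, Finset.sum_add_distrib, Finset.mul_sum]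
  have (i : Fin m) (j : Fin n) : bval (h j) * (bval (v i) * W i j) =
    bval (v i) * W i j * bval (h j) := by ring
  simp_rw [this]
  ring

/-- The Hamming distance to a fixed point of the cube is an affine function. -/
theorem hammingDist_eq_affine {m : ℕ} (u v : Fin m → Bool) :
    (hammingDist u v : ℝ) = ∑ i, bval (v i) * (1 - 2 * bval (u i)) + ∑ i, bval (u i) := by
  rw [hammingDist, Finset.card_filter, ← Finset.sum_add_distrib]
  push_cast
  refine Finset.sum_congr rfl fun i _ => ?_
  cases u i <;> cases v i <;> norm_num [bval]

theorem tendsto_exp_mul_one_sub_two_mul_hammingDist {m : ℕ} {u v : Fin m → Bool} (h : u ≠ v) :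
    Tendsto (fun a : ℝ => Real.exp (a * (1 - 2 * (hammingDist u v : ℝ)))) atTop (nhds 0) := by
  have h1 : (1 : ℝ) ≤ hammingDist u v := by exact_mod_cast hammingDist_pos.2 h
  exact Real.tendsto_exp_atBot.comp (tendsto_id.atTop_mul_const_of_neg (by linarith))

/-- Hidden units sharply peaked at the points `u`, with heights `μ u * exp a`, produce a visible
marginal which rescales to `μ` as `a → ∞`. -/
theorem tendsto_prod_peaks {m : ℕ} (μ : (Fin m → Bool) → ℝ) (v : Fin m → Bool) :
    Tendsto (fun a : ℝ => Real.exp (-a) *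
      ∏ u, (1 + μ u * Real.exp (a * (1 - 2 * (hammingDist u v : ℝ))))) atTop (nhds (μ v)) := by
  have hv : Tendsto (fun a : ℝ => Real.exp (-a) + μ v) atTop (nhds (0 + μ v)) :=
    (Real.tendsto_exp_neg_atTop_nhds_zero).add_const _
  have hrest : Tendsto (fun a : ℝ => ∏ u ∈ Finset.univ.erase v,
      (1 + μ u * Real.exp (a * (1 - 2 * (hammingDist u v : ℝ))))) atTop
      (nhds (∏ u ∈ Finset.univ.erase v, (1 + μ u * 0))) :=
    tendsto_finsetProd _ fun u hu =>
      ((tendsto_exp_mul_one_sub_two_mul_hammingDist (Finset.ne_of_mem_erase hu)).const_mul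
        _).const_add _
  have := hv.mul hrest
  simp only [mul_zero, add_zero, Finset.prod_const_one, mul_one, zero_add] at this
  refine this.congr fun a => ?_
  rw [← Finset.mul_prod_erase _ _ (Finset.mem_univ v), ← mul_assoc]
  congr 1
  have : Real.exp (-a) * Real.exp a = 1 := by rw [← Real.exp_add]; simp
  simp only [hammingDist_self, Nat.cast_zero, mul_zero, sub_zero, mul_one]
  linear_combination -μ v * this

/-- With `s + 1` hidden units, one idle and the others peaked at the support of `μ`, the
unnormalized visible marginal is, up to a factor two, a product over the cube. -/
theorem exists_sum_rbmWeight_eq_prod_peaks {m : ℕ} {μ : (Fin m → Bool) → ℝ} (hμ0 : ∀ v, 0 ≤ μ v)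
    {s : ℕ} (hs : s = (Finset.univ.filter fun v : Fin m → Bool => 0 < μ v).card) (a : ℝ) :
    ∃ (W : Matrix (Fin m) (Fin (s + 1)) ℝ) (c : Fin (s + 1) → ℝ), ∀ v,
      ∑ h, rbmWeight W 0 c v h =
        2 * ∏ u, (1 + μ u * Real.exp (a * (1 - 2 * (hammingDist u v : ℝ)))) := by
  set S := Finset.univ.filter fun v : Fin m → Bool => 0 < μ v with hS
  let e : Fin s ≃ S := (S.equivFinOfCardEq hs.symm).symm
  refine ⟨Matrix.of fun i => Fin.cons 0 fun k => -2 * a * (1 - 2 * bval ((e k).1 i)),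
    Fin.cons 0 fun k => Real.log (μ (e k)) + a - 2 * a * ∑ i, bval ((e k).1 i), fun v => ?_⟩
  rw [sum_rbmWeight, Fin.prod_univ_succ]
  have hk (k : Fin s) : Real.exp (∑ i, bval (v i) * (-2 * a * (1 - 2 * bval ((e k).1 i))) +
      (Real.log (μ (e k)) + a - 2 * a * ∑ i, bval ((e k).1 i))) =
      μ (e k) * Real.exp (a * (1 - 2 * (hammingDist (e k).1 v : ℝ))) := by
    have hpos : 0 < μ (e k) := (Finset.mem_filter.1 (e k).2).2
    nth_rw 2 [← Real.exp_log hpos]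
    rw [← Real.exp_add, hammingDist_eq_affine]
    have (i : Fin m) : bval (v i) * (-2 * a * (1 - 2 * bval ((e k).1 i))) =
      -2 * a * (bval (v i) * (1 - 2 * bval ((e k).1 i))) := by ring
    simp_rw [this]
    rw [← Finset.mul_sum]
    congr 1
    ring
  simp only [Matrix.of_apply, Fin.cons_zero, Fin.cons_succ, hk, Pi.zero_apply, mul_zero,
    Finset.sum_const_zero, Real.exp_zero, one_mul, add_zero, one_add_one_eq_two]
  congr 1
  rw [e.prod_comp fun u : S => 1 + μ u * Real.exp (a * (1 - 2 * (hammingDist u.1 v : ℝ))),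
    Finset.prod_coe_sort S fun u => 1 + μ u * Real.exp (a * (1 - 2 * (hammingDist u v : ℝ)))]
  refine Finset.prod_subset (Finset.subset_univ _) fun u _ hu => ?_
  have : μ u = 0 := le_antisymm (by simpa [hS] using hu) (hμ0 u)
  simp [this]

/-- Theorem 2 of Le Roux–Bengio: any distribution on `{0,1}^m` with support of size `s` can be
approximated to accuracy `ε` by a binary-binary RBM with `m` visible and `s + 1` hidden units. -/
theorem rbm_universal_approximation (m : ℕ) (μ : (Fin m → Bool) → ℝ)
    (hμ0 : ∀ v, 0 ≤ μ v) (hμ1 : ∑ v : Fin m → Bool, μ v = 1)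
    (s : ℕ) (hs : s = (Finset.univ.filter fun v : Fin m → Bool => 0 < μ v).card)
    (ε : ℝ) (hε : 0 < ε) :
    ∃ π : (Fin m → Bool) → (Fin (s + 1) → Bool) → ℝ, IsRBM π ∧
      ∀ v : Fin m → Bool, |μ v - ∑ h : Fin (s + 1) → Bool, π v h| ≤ ε := by
  let F (a : ℝ) (v : Fin m → Bool) : ℝ :=
    ∏ u, (1 + μ u * Real.exp (a * (1 - 2 * (hammingDist u v : ℝ))))
  have hF (v : Fin m → Bool) : Tendsto (fun a => F a v / ∑ w, F a w) atTop (nhds (μ v)) := by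
    have := (tendsto_prod_peaks μ v).div
      (tendsto_finsetSum Finset.univ fun w _ => tendsto_prod_peaks μ w) (by simp [hμ1])
    rw [hμ1, div_one] at this
    refine this.congr fun a => ?_
    simp only [Pi.div_apply, ← Finset.mul_sum]
    exact mul_div_mul_left _ _ (Real.exp_pos _).ne'
  obtain ⟨a, ha⟩ := (eventually_all.2 fun v =>
    (hF v).eventually (Metric.closedBall_mem_nhds (μ v) hε)).exists
  obtain ⟨W, c, hW⟩ := exists_sum_rbmWeight_eq_prod_peaks hμ0 hs a
  refine ⟨_, ⟨W, 0, c, fun _ _ => rfl⟩, fun v => ?_⟩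
  rw [← Finset.sum_div]
  simp_rw [hW]
  rw [← Finset.mul_sum, mul_div_mul_left _ _ two_ne_zero, abs_sub_comm]
  exact ha v
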